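/- Let r ≥ 3 and let n_1,…,n_r be positive integers with n_1 ≤ n_i for all i. Then φ*(n_1, n_2, …, n_r) = Σ_{S ⊆ {2,…,r−1}} C(n_1 + 1, |S|+1) · φ*_{S∪{1}}(n_2, …, n_r), where for a set S_1 = {i_1 < i_2 < ⋯ < i_s} ⊆ {1,…,r−1} with i_1 = 1 one defines φ*_{S_1}(n_2,…,n_r) := (Π_{j=1}^{s−1} φ*(n_{i_j + 1}, …, n_{i_{j+1}})) · φ*(n_{i_s + 1}, …, n_r). -/

import Mathlib

/-- A pairing of the positions `Fin N`: a collection of blocks, each of size 2,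
with every position in exactly one block. -/
def IsPairing {N : ℕ} (π : Finset (Finset (Fin N))) : Prop :=
  (∀ B ∈ π, B.card = 2) ∧ ∀ i : Fin N, ∃! B, B ∈ π ∧ i ∈ B

/-- A crossing: blocks `{i₁,i₂}` and `{j₁,j₂}` with `i₁ < j₁ < i₂ < j₂`. -/
def HasCrossing {N : ℕ} (π : Finset (Finset (Fin N))) : Prop :=
  ∃ B ∈ π, ∃ C ∈ π, ∃ i₁ i₂ j₁ j₂ : Fin N,
    i₁ ∈ B ∧ i₂ ∈ B ∧ j₁ ∈ C ∧ j₂ ∈ C ∧ i₁ < j₁ ∧ j₁ < i₂ ∧ i₂ < j₂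

/-- A non-crossing `w`-pairing: a non-crossing pairing of the positions of the
bitstring `w` (ones are `true`, zeros are `false`) pairing unequal letters. -/
def IsNCPairingOn (w : List Bool) (π : Finset (Finset (Fin w.length))) : Prop :=
  IsPairing π ∧ ¬ HasCrossing π ∧
    ∀ B ∈ π, ∀ i ∈ B, ∀ j ∈ B, i ≠ j → w.get i ≠ w.get j

/-- `phi w` is the number of non-crossing `w`-pairings. -/
noncomputable def phi (w : List Bool) : ℕ :=
  Set.ncard {π : Finset (Finset (Fin w.length)) | IsNCPairingOn w π}

/-- The word `1^{n 0} 0^{m 0} 1^{n 1} 0^{m 1} ⋯ 1^{n (r-1)} 0^{m (r-1)}`. -/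
def runsF {r : ℕ} (n m : Fin r → ℕ) : List Bool :=
  (List.finRange r).flatMap fun i => List.replicate (n i) true ++ List.replicate (m i) false

/-- The word `1^{k₁} 0^{k₁} ⋯ 1^{k_r} 0^{k_r}` for `l = [k₁, …, k_r]`. -/
def symWord (l : List ℕ) : List Bool :=
  l.flatMap fun k => List.replicate k true ++ List.replicate k false

/-- The symmetrized pairing function `φ*(n₁,…,n_r) = φ(1^{n₁}0^{n₁}⋯1^{n_r}0^{n_r})`. -/
noncomputable def phiStar (l : List ℕ) : ℕ := phi (symWord l)

/-- `Yval w i` is the lattice-path value `Y_i`. -/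
def Yval (w : List Bool) (i : ℕ) : ℤ :=
  ((w.take i).count true : ℤ) - ((w.take i).count false : ℤ)

/-- The height of position `i` of `w`, relative to the minimum `mY` of the `Y_i`. -/
def heightAt (w : List Bool) (mY : ℤ) (i : Fin w.length) : ℤ :=
  if w.get i then Yval w (i.val + 1) - mY else Yval w (i.val + 1) - mY + 1

/-- `d : Fin r → ℕ` is a Catalan degree sequence of order `r`. -/
def IsCatalanSeq (r : ℕ) (d : Fin r → ℕ) : Prop :=
  (∀ i : ℕ, 1 ≤ i → i ≤ r - 1 →
      (i : ℕ) ≤ ∑ j ∈ Finset.univ.filter (fun j : Fin r => (j : ℕ) < i), d j) ∧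
  ∑ j, d j = r - 1

/-- Sum of the first `j` values of `f`. -/
def prefSum {r : ℕ} (f : Fin r → ℕ) (j : ℕ) : ℕ :=
  ∑ i ∈ Finset.univ.filter (fun i : Fin r => (i : ℕ) < j), f i

/-- `m` is a member of `CF(n)`. -/
def InCF {r : ℕ} (n m : Fin r → ℕ) : Prop :=
  (∀ j : ℕ, 1 ≤ j → j ≤ r - 1 → prefSum m j ≤ prefSum n j) ∧
  (∑ i, m i = ∑ i, n i)

/-- Given `t = [n₂,…,n_r]` and the sorted list `L = [i₁ < ⋯ < i_s]` of the
cut-set `S₁ ⊆ {1,…,r-1}`, this is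
`φ*_{S₁}(n₂,…,n_r) = (Π_{j=1}^{s-1} φ*(n_{i_j+1},…,n_{i_{j+1}})) · φ*(n_{i_s+1},…,n_r)`. -/
noncomputable def phiStarCuts (t : List ℕ) (r : ℕ) (L : List ℕ) : ℕ :=
  ((L.zip (L.tail ++ [r])).map fun p => phiStar ((t.drop (p.1 - 1)).take (p.2 - p.1))).prod

/-- The non-crossing pairings of the finite set `s` that pair letters of different colour. -/
def ncSet (s : Finset ℕ) (c : ℕ → Bool) : Set (Finset (Finset ℕ)) :=
  {π | (∀ B ∈ π, B ⊆ s ∧ B.card = 2) ∧ (∀ i ∈ s, ∃! B, B ∈ π ∧ i ∈ B) ∧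
    (∀ B ∈ π, ∀ C ∈ π, ∀ i₁ ∈ B, ∀ i₂ ∈ B, ∀ j₁ ∈ C, ∀ j₂ ∈ C,
      ¬ (i₁ < j₁ ∧ j₁ < i₂ ∧ i₂ < j₂)) ∧
    ∀ B ∈ π, ∀ i ∈ B, ∀ j ∈ B, i ≠ j → c i ≠ c j}

open Classical in
/-- `ncSet` as a `Finset`. -/
noncomputable def ncFinset (s : Finset ℕ) (c : ℕ → Bool) : Finset (Finset (Finset ℕ)) :=
  s.powerset.powerset.filter (· ∈ ncSet s c)

theorem mem_ncFinset {s : Finset ℕ} {c : ℕ → Bool} {π : Finset (Finset ℕ)} :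
    π ∈ ncFinset s c ↔ π ∈ ncSet s c := by
  classical
  simp only [ncFinset, Finset.mem_filter, Finset.mem_powerset, and_iff_right_iff_imp]
  exact fun h B hB => Finset.mem_powerset.2 (h.1 B hB).1

/-- Counting the pairings of a word after a renaming `f` of its positions that preserves the
crossing relation up to cyclic rotation. -/
theorem phi_eq_card_ncFinset_of_embedding (w : List Bool) (s : Finset ℕ) (c : ℕ → Bool)
    (f : Fin w.length ↪ ℕ) (hfs : ∀ x, x ∈ s ↔ ∃ i, f i = x) (hfc : ∀ i, c (f i) = w.get i)
    (hcr : ∀ i₁ j₁ i₂ j₂, f i₁ < f j₁ → f j₁ < f i₂ → f i₂ < f j₂ →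
      (i₁ < j₁ ∧ j₁ < i₂ ∧ i₂ < j₂) ∨ (j₂ < i₁ ∧ i₁ < j₁ ∧ j₁ < i₂) ∨
        (j₁ < i₂ ∧ i₂ < j₂ ∧ j₂ < i₁))
    (hcr' : ∀ i₁ j₁ i₂ j₂, i₁ < j₁ → j₁ < i₂ → i₂ < j₂ →
      (f i₁ < f j₁ ∧ f j₁ < f i₂ ∧ f i₂ < f j₂) ∨ (f j₂ < f i₁ ∧ f i₁ < f j₁ ∧ f j₁ < f i₂) ∨
        (f j₁ < f i₂ ∧ f i₂ < f j₂ ∧ f j₂ < f i₁)) :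
    phi w = (ncFinset s c).card := by
  classical
  let g : Finset (Finset (Fin w.length)) → Finset (Finset ℕ) :=
    fun π => π.map (Finset.mapEmbedding f).toEmbedding
  have hg : Function.Injective g := Finset.map_injective _
  have hmem : ∀ π B, B ∈ g π ↔ ∃ A ∈ π, A.map f = B := by
    intro π B
    simp [g]
  have key : g '' {π | IsNCPairingOn w π} = ↑(ncFinset s c) := by
    ext ρ
    simp only [Set.mem_image, Set.mem_ofPred_eq, Finset.mem_coe, mem_ncFinset]
    constructor
    · rintro ⟨π, ⟨⟨h1, h2⟩, h3, h4⟩, rfl⟩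
      refine ⟨?_, ?_, ?_, ?_⟩
      · intro B hB
        obtain ⟨A, hA, rfl⟩ := (hmem _ _).1 hB
        refine ⟨?_, by simpa using h1 A hA⟩
        intro x hx
        obtain ⟨i, -, rfl⟩ := Finset.mem_map.1 hx
        exact (hfs _).2 ⟨i, rfl⟩
      · intro x hx
        obtain ⟨i, rfl⟩ := (hfs x).1 hx
        obtain ⟨A, ⟨hA, hiA⟩, hu⟩ := h2 i
        refine ⟨A.map f, ⟨(hmem _ _).2 ⟨A, hA, rfl⟩, Finset.mem_map_of_mem f hiA⟩, ?_⟩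
        rintro B ⟨hB, hiB⟩
        obtain ⟨A', hA', rfl⟩ := (hmem _ _).1 hB
        rw [hu A' ⟨hA', (Finset.mem_map' f).1 hiB⟩]
      · intro B' hB' C' hC' x₁ hx₁ x₂ hx₂ y₁ hy₁ y₂ hy₂ hlt
        obtain ⟨B, hB, rfl⟩ := (hmem _ _).1 hB'
        obtain ⟨C, hC, rfl⟩ := (hmem _ _).1 hC'
        obtain ⟨i₁, hi₁, rfl⟩ := Finset.mem_map.1 hx₁
        obtain ⟨i₂, hi₂, rfl⟩ := Finset.mem_map.1 hx₂
        obtain ⟨j₁, hj₁, rfl⟩ := Finset.mem_map.1 hy₁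
        obtain ⟨j₂, hj₂, rfl⟩ := Finset.mem_map.1 hy₂
        rcases hcr i₁ j₁ i₂ j₂ hlt.1 hlt.2.1 hlt.2.2 with h | h | h
        · exact h3 ⟨B, hB, C, hC, i₁, i₂, j₁, j₂, hi₁, hi₂, hj₁, hj₂, h⟩
        · exact h3 ⟨C, hC, B, hB, j₂, j₁, i₁, i₂, hj₂, hj₁, hi₁, hi₂, h⟩
        · exact h3 ⟨C, hC, B, hB, j₁, j₂, i₂, i₁, hj₁, hj₂, hi₂, hi₁, h⟩
      · intro B' hB' x hx y hy hxy
        obtain ⟨B, hB, rfl⟩ := (hmem _ _).1 hB'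
        obtain ⟨i, hi, rfl⟩ := Finset.mem_map.1 hx
        obtain ⟨j, hj, rfl⟩ := Finset.mem_map.1 hy
        rw [hfc, hfc]
        exact h4 B hB i hi j hj (fun e => hxy (by rw [e]))
    · rintro ⟨h1, h2, h3, h4⟩
      have hpre : ∀ B ∈ ρ, ∃ A : Finset (Fin w.length), A.map f = B := by
        intro B hB
        refine ⟨Finset.univ.filter fun i => f i ∈ B, ?_⟩
        ext x
        simp only [Finset.mem_map, Finset.mem_filter, Finset.mem_univ, true_and]
        constructor
        · rintro ⟨i, hi, rfl⟩
          exact hi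
        · intro hx
          obtain ⟨i, rfl⟩ := (hfs x).1 ((h1 B hB).1 hx)
          exact ⟨i, hx, rfl⟩
      let π : Finset (Finset (Fin w.length)) := Finset.univ.filter fun A => A.map f ∈ ρ
      have hπ : ∀ A, A ∈ π ↔ A.map f ∈ ρ := fun A => by simp [π]
      refine ⟨π, ⟨⟨?_, ?_⟩, ?_, ?_⟩, ?_⟩
      · intro A hA
        simpa using (h1 _ ((hπ A).1 hA)).2
      · intro i
        obtain ⟨B, ⟨hB, hiB⟩, hu⟩ := h2 (f i) ((hfs _).2 ⟨i, rfl⟩)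
        obtain ⟨A, rfl⟩ := hpre B hB
        refine ⟨A, ⟨(hπ A).2 hB, (Finset.mem_map' f).1 hiB⟩, ?_⟩
        rintro A' ⟨hA', hiA'⟩
        exact Finset.map_injective f
          (hu (A'.map f) ⟨(hπ A').1 hA', Finset.mem_map_of_mem f hiA'⟩)
      · rintro ⟨B, hB, C, hC, i₁, i₂, j₁, j₂, hi₁, hi₂, hj₁, hj₂, hlt⟩
        have m₁ := Finset.mem_map_of_mem f hi₁
        have m₂ := Finset.mem_map_of_mem f hi₂
        have m₃ := Finset.mem_map_of_mem f hj₁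
        have m₄ := Finset.mem_map_of_mem f hj₂
        have hB' := (hπ B).1 hB
        have hC' := (hπ C).1 hC
        rcases hcr' i₁ j₁ i₂ j₂ hlt.1 hlt.2.1 hlt.2.2 with h | h | h
        · exact h3 _ hB' _ hC' _ m₁ _ m₂ _ m₃ _ m₄ h
        · exact h3 _ hC' _ hB' _ m₄ _ m₃ _ m₁ _ m₂ h
        · exact h3 _ hC' _ hB' _ m₃ _ m₄ _ m₂ _ m₁ h
      · intro B hB i hi j hj hij
        rw [← hfc, ← hfc]
        exact h4 _ ((hπ B).1 hB) _ (Finset.mem_map_of_mem f hi) _ (Finset.mem_map_of_mem f hj)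
          (fun e => hij (f.injective e))
      · ext B
        rw [hmem]
        constructor
        · rintro ⟨A, hA, rfl⟩
          exact (hπ A).1 hA
        · intro hB
          obtain ⟨A, rfl⟩ := hpre B hB
          exact ⟨A, (hπ A).2 hB, rfl⟩
  rw [phi, ← Set.ncard_image_of_injective _ hg, key, Set.ncard_coe_finset]

theorem phi_eq_card_ncFinset (w : List Bool) (m : ℕ) (c : ℕ → Bool)
    (h : ∀ i : Fin w.length, c (m + i) = w.get i) :
    phi w = (ncFinset (Finset.Ico m (m + w.length)) c).card := by
  let f : Fin w.length ↪ ℕ := ⟨fun i => m + i, fun i j hij => Fin.ext (by simpa using hij)⟩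
  have hf : ∀ i, f i = m + i := fun _ => rfl
  have hfl : ∀ i j, f i < f j ↔ i < j := fun i j => by simp [hf]
  refine phi_eq_card_ncFinset_of_embedding w _ c f ?_ h ?_ ?_
  · intro x
    rw [Finset.mem_Ico]
    constructor
    · rintro ⟨h1, h2⟩
      exact ⟨⟨x - m, by omega⟩, by simp only [hf]; omega⟩
    · rintro ⟨i, rfl⟩
      have := i.2
      simp only [hf]
      omega
  · intro i₁ j₁ i₂ j₂ h1 h2 h3
    simp only [hfl] at h1 h2 h3
    exact Or.inl ⟨h1, h2, h3⟩
  · intro i₁ j₁ i₂ j₂ h1 h2 h3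
    simp only [hfl]
    exact Or.inl ⟨h1, h2, h3⟩

/-- Every block of a non-crossing pairing containing the arc `{a, k}`, with `a` minimal, is that
arc or lies on one side of `k`. -/
theorem block_cases {s : Finset ℕ} {c : ℕ → Bool} {a k : ℕ} (ha : ∀ x ∈ s, a < x)
    (hk : k ∈ s) {π : Finset (Finset ℕ)} (hπ : π ∈ ncSet (insert a s) c) (hak : {a, k} ∈ π)
    {B : Finset ℕ} (hB : B ∈ π) :
    B = {a, k} ∨ B ⊆ s.filter (· < k) ∨ B ⊆ s.filter (k < ·) := by
  obtain ⟨h1, h2, h3, h4⟩ := hπ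
  by_cases hne : B = {a, k}
  · exact Or.inl hne
  right
  have hd : ∀ x ∈ B, x ∈ s ∧ x ≠ k := by
    intro x hx
    have hxa : x ≠ a := by
      rintro rfl
      exact hne ((h2 x (Finset.mem_insert_self _ _)).unique ⟨hB, hx⟩ ⟨hak, by simp⟩)
    refine ⟨(Finset.mem_insert.1 ((h1 B hB).1 hx)).resolve_left hxa, ?_⟩
    rintro rfl
    exact hne ((h2 x (Finset.mem_insert_of_mem hk)).unique ⟨hB, hx⟩ ⟨hak, by simp⟩)
  by_contra! hcon
  obtain ⟨hc1, hc2⟩ := hcon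
  obtain ⟨x, hx, hx'⟩ := Finset.not_subset.1 hc1
  obtain ⟨y, hy, hy'⟩ := Finset.not_subset.1 hc2
  have hxs := hd x hx
  have hys := hd y hy
  simp only [Finset.mem_filter, not_and, not_lt] at hx' hy'
  have e1 := hx' hxs.1
  have e2 := hy' hys.1
  have e3 := ha y hys.1
  exact h3 _ hak B hB a (by simp) k (by simp) y hy x hx ⟨e3, by omega, by omega⟩

theorem insert_union_mem_ncSet {s : Finset ℕ} {c : ℕ → Bool} {a k : ℕ} (ha : ∀ x ∈ s, a < x)
    (hk : k ∈ s) (hc : c k ≠ c a) {π₁ π₂ : Finset (Finset ℕ)}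
    (h₁ : π₁ ∈ ncSet (s.filter (· < k)) c) (h₂ : π₂ ∈ ncSet (s.filter (k < ·)) c) :
    insert {a, k} (π₁ ∪ π₂) ∈ ncSet (insert a s) c := by
  obtain ⟨p1, p2, p3, p4⟩ := h₁
  obtain ⟨q1, q2, q3, q4⟩ := h₂
  have hak := ha k hk
  have hp : ∀ B ∈ π₁, ∀ x ∈ B, x ∈ s ∧ x < k := fun B hB x hx =>
    Finset.mem_filter.1 ((p1 B hB).1 hx)
  have hq : ∀ B ∈ π₂, ∀ x ∈ B, x ∈ s ∧ k < x := fun B hB x hx =>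
    Finset.mem_filter.1 ((q1 B hB).1 hx)
  have hp' : ∀ B ∈ π₁, ∀ x ∈ B, a < x ∧ x < k := fun B hB x hx =>
    ⟨ha x (hp B hB x hx).1, (hp B hB x hx).2⟩
  have hq' : ∀ B ∈ π₂, ∀ x ∈ B, k < x := fun B hB x hx => (hq B hB x hx).2
  have hm : ∀ B, B ∈ insert {a, k} (π₁ ∪ π₂) ↔ B = {a, k} ∨ B ∈ π₁ ∨ B ∈ π₂ := by
    intro B; simp
  have hx : ∀ x, x ∈ ({a, k} : Finset ℕ) ↔ x = a ∨ x = k := by intro x; simp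
  refine ⟨?_, ?_, ?_, ?_⟩
  · intro B hB
    rcases (hm B).1 hB with rfl | hB | hB
    · refine ⟨?_, Finset.card_pair hak.ne⟩
      intro x hx'
      rcases (hx x).1 hx' with rfl | rfl
      · exact Finset.mem_insert_self _ _
      · exact Finset.mem_insert_of_mem hk
    · exact ⟨fun x hx => Finset.mem_insert_of_mem (hp B hB x hx).1, (p1 B hB).2⟩
    · exact ⟨fun x hx => Finset.mem_insert_of_mem (hq B hB x hx).1, (q1 B hB).2⟩
  · intro i hi
    have hi' : (i = a ∨ i = k) ∨ (a < i ∧ i < k ∧ i ∈ s) ∨ (k < i ∧ i ∈ s) := by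
      rcases Finset.mem_insert.1 hi with rfl | his
      · simp
      · have := ha i his
        rcases lt_trichotomy i k with h | h | h <;> simp [*]
    rcases hi' with hi' | ⟨hi1, hi2, his⟩ | ⟨hi1, his⟩
    · refine ⟨{a, k}, ⟨(hm _).2 (Or.inl rfl), (hx i).2 hi'⟩, ?_⟩
      rintro B ⟨hB, hiB⟩
      rcases (hm B).1 hB with rfl | hB | hB
      · rfl
      · have := hp' B hB i hiB; omega
      · have := hq' B hB i hiB; omega
    · obtain ⟨A, ⟨hA, hiA⟩, hu⟩ := p2 i (Finset.mem_filter.2 ⟨his, hi2⟩)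
      refine ⟨A, ⟨(hm _).2 (Or.inr (Or.inl hA)), hiA⟩, ?_⟩
      rintro B ⟨hB, hiB⟩
      rcases (hm B).1 hB with rfl | hB | hB
      · have := (hx i).1 hiB; omega
      · exact hu B ⟨hB, hiB⟩
      · have := hq' B hB i hiB; omega
    · obtain ⟨A, ⟨hA, hiA⟩, hu⟩ := q2 i (Finset.mem_filter.2 ⟨his, hi1⟩)
      refine ⟨A, ⟨(hm _).2 (Or.inr (Or.inr hA)), hiA⟩, ?_⟩
      rintro B ⟨hB, hiB⟩
      rcases (hm B).1 hB with rfl | hB | hB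
      · have := (hx i).1 hiB; omega
      · have := hp' B hB i hiB; omega
      · exact hu B ⟨hB, hiB⟩
  · intro B hB C hC i₁ hi₁ i₂ hi₂ j₁ hj₁ j₂ hj₂ hlt
    have hb : ∀ B, B ∈ insert {a, k} (π₁ ∪ π₂) → (∀ x ∈ B, x = a ∨ x = k) ∨
        (B ∈ π₁ ∧ ∀ x ∈ B, a < x ∧ x < k) ∨ (B ∈ π₂ ∧ ∀ x ∈ B, k < x) := by
      intro B hB
      rcases (hm B).1 hB with rfl | hB | hB
      · exact Or.inl fun x => (hx x).1
      · exact Or.inr (Or.inl ⟨hB, hp' B hB⟩)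
      · exact Or.inr (Or.inr ⟨hB, hq' B hB⟩)
    rcases hb B hB with h | ⟨h0, h⟩ | ⟨h0, h⟩ <;>
      rcases hb C hC with h' | ⟨h0', h'⟩ | ⟨h0', h'⟩ <;>
      first
      | exact p3 B h0 C h0' i₁ hi₁ i₂ hi₂ j₁ hj₁ j₂ hj₂ hlt
      | exact q3 B h0 C h0' i₁ hi₁ i₂ hi₂ j₁ hj₁ j₂ hj₂ hlt
      | (have := h i₁ hi₁
         have := h i₂ hi₂
         have := h' j₁ hj₁
         have := h' j₂ hj₂
         omega)
  · intro B hB i hi j hj hij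
    rcases (hm B).1 hB with rfl | hB | hB
    · rcases (hx i).1 hi with rfl | rfl <;> rcases (hx j).1 hj with rfl | rfl
      · exact absurd rfl hij
      · exact hc.symm
      · exact hc
      · exact absurd rfl hij
    · exact p4 B hB i hi j hj hij
    · exact q4 B hB i hi j hj hij

theorem filter_subset_mem_ncSet {s t : Finset ℕ} {c : ℕ → Bool} (hts : t ⊆ s)
    {π : Finset (Finset ℕ)} (hπ : π ∈ ncSet s c)
    (hcov : ∀ B ∈ π, ∀ i ∈ B, i ∈ t → B ⊆ t) :
    π.filter (· ⊆ t) ∈ ncSet t c := by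
  obtain ⟨h1, h2, h3, h4⟩ := hπ
  refine ⟨?_, ?_, ?_, ?_⟩
  · intro B hB
    rw [Finset.mem_filter] at hB
    exact ⟨hB.2, (h1 B hB.1).2⟩
  · intro i hi
    obtain ⟨B, ⟨hB, hiB⟩, hu⟩ := h2 i (hts hi)
    exact ⟨B, ⟨Finset.mem_filter.2 ⟨hB, hcov B hB i hiB hi⟩, hiB⟩,
      fun C hC => hu C ⟨(Finset.mem_filter.1 hC.1).1, hC.2⟩⟩
  · intro B hB C hC
    exact h3 B (Finset.mem_filter.1 hB).1 C (Finset.mem_filter.1 hC).1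
  · intro B hB
    exact h4 B (Finset.mem_filter.1 hB).1

theorem card_filter_pair_mem {s : Finset ℕ} {c : ℕ → Bool} {a k : ℕ} (ha : ∀ x ∈ s, a < x)
    (hk : k ∈ s) (hc : c k ≠ c a) :
    ((ncFinset (insert a s) c).filter ({a, k} ∈ ·)).card =
      (ncFinset (s.filter (· < k)) c).card * (ncFinset (s.filter (k < ·)) c).card := by
  classical
  rw [← Finset.card_product]
  have hne : ∀ {t : Finset ℕ} {π : Finset (Finset ℕ)} {B}, π ∈ ncSet t c → B ∈ π →
      ∃ x ∈ B, x ∈ t := by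
    intro t π B hπ hB
    obtain ⟨x, hx⟩ := Finset.card_pos.1 (by rw [(hπ.1 B hB).2]; norm_num : 0 < B.card)
    exact ⟨x, hx, (hπ.1 B hB).1 hx⟩
  refine Finset.card_nbij' (fun π => (π.filter (· ⊆ s.filter (· < k)),
    π.filter (· ⊆ s.filter (k < ·)))) (fun p => insert {a, k} (p.1 ∪ p.2)) ?_ ?_ ?_ ?_
  · intro π hπ
    simp only [Finset.coe_filter, Set.mem_ofPred_eq, mem_ncFinset] at hπ
    simp only [Finset.coe_product, Set.mem_prod, Finset.mem_coe, mem_ncFinset]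
    have hb := fun B hB => block_cases (B := B) ha hk hπ.1 hπ.2 hB
    constructor
    · refine filter_subset_mem_ncSet
        ((Finset.filter_subset _ _).trans (Finset.subset_insert _ _)) hπ.1 ?_
      intro B hB i hi hit
      rw [Finset.mem_filter] at hit
      rcases hb B hB with rfl | h | h
      · have := ha i hit.1
        simp only [Finset.mem_insert, Finset.mem_singleton] at hi
        omega
      · exact h
      · have := (Finset.mem_filter.1 (h hi)).2
        omega
    · refine filter_subset_mem_ncSet
        ((Finset.filter_subset _ _).trans (Finset.subset_insert _ _)) hπ.1 ?_
      intro B hB i hi hit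
      rw [Finset.mem_filter] at hit
      rcases hb B hB with rfl | h | h
      · have := ha i hit.1
        simp only [Finset.mem_insert, Finset.mem_singleton] at hi
        omega
      · have := (Finset.mem_filter.1 (h hi)).2
        omega
      · exact h
  · rintro ⟨π₁, π₂⟩ hp
    simp only [Finset.coe_product, Set.mem_prod, Finset.mem_coe, mem_ncFinset] at hp
    simp only [Finset.coe_filter, Set.mem_ofPred_eq, mem_ncFinset]
    exact ⟨insert_union_mem_ncSet ha hk hc hp.1 hp.2, Finset.mem_insert_self _ _⟩
  · intro π hπ
    simp only [Finset.coe_filter, Set.mem_ofPred_eq, mem_ncFinset] at hπ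
    ext B
    simp only [Finset.mem_insert, Finset.mem_union, Finset.mem_filter (s := π)]
    constructor
    · rintro (rfl | h | h)
      · exact hπ.2
      · exact h.1
      · exact h.1
    · intro hB
      have := block_cases ha hk hπ.1 hπ.2 hB
      tauto
  · rintro ⟨π₁, π₂⟩ hp
    simp only [Finset.coe_product, Set.mem_prod, Finset.mem_coe, mem_ncFinset] at hp
    obtain ⟨h1, h2⟩ := hp
    have n1 : ¬ ({a, k} : Finset ℕ) ⊆ s.filter (· < k) := fun h => by
      simpa using h (by simp : k ∈ ({a, k} : Finset ℕ))
    have n2 : ¬ ({a, k} : Finset ℕ) ⊆ s.filter (k < ·) := fun h => by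
      simpa using h (by simp : k ∈ ({a, k} : Finset ℕ))
    have n3 : ∀ B ∈ π₁, ¬ B ⊆ s.filter (k < ·) := by
      intro B hB hsub
      obtain ⟨x, hx, hx'⟩ := hne h1 hB
      have e1 := (Finset.mem_filter.1 hx').2
      have e2 := (Finset.mem_filter.1 (hsub hx)).2
      omega
    have n4 : ∀ B ∈ π₂, ¬ B ⊆ s.filter (· < k) := by
      intro B hB hsub
      obtain ⟨x, hx, hx'⟩ := hne h2 hB
      have e1 := (Finset.mem_filter.1 hx').2
      have e2 := (Finset.mem_filter.1 (hsub hx)).2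
      omega
    have n5 : ∀ B ∈ π₁, B ⊆ s.filter (· < k) := fun B hB => (h1.1 B hB).1
    have n6 : ∀ B ∈ π₂, B ⊆ s.filter (k < ·) := fun B hB => (h2.1 B hB).1
    refine Prod.ext ?_ ?_
    · ext B
      simp only [Finset.mem_insert, Finset.mem_union, Finset.mem_filter (s := insert _ _)]
      constructor
      · rintro ⟨rfl | h | h, hs⟩
        · exact absurd hs n1
        · exact h
        · exact absurd hs (n4 B h)
      · exact fun h => ⟨Or.inr (Or.inl h), n5 B h⟩
    · ext B
      simp only [Finset.mem_insert, Finset.mem_union, Finset.mem_filter (s := insert _ _)]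
      constructor
      · rintro ⟨rfl | h | h, hs⟩
        · exact absurd hs n2
        · exact absurd hs (n3 B h)
        · exact h
      · exact fun h => ⟨Or.inr (Or.inr h), n6 B h⟩

theorem card_ncFinset_insert {s : Finset ℕ} {c : ℕ → Bool} {a : ℕ} (ha : ∀ x ∈ s, a < x) :
    (ncFinset (insert a s) c).card = ∑ k ∈ s.filter (fun k => c k ≠ c a),
      (ncFinset (s.filter (· < k)) c).card * (ncFinset (s.filter (k < ·)) c).card := by
  classical
  have hU : ncFinset (insert a s) c = (s.filter (fun k => c k ≠ c a)).biUnion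
      fun k => (ncFinset (insert a s) c).filter ({a, k} ∈ ·) := by
    ext π
    simp only [Finset.mem_biUnion, Finset.mem_filter (s := s),
      Finset.mem_filter (s := ncFinset (insert a s) c)]
    constructor
    · intro hπ
      obtain ⟨h1, h2, h3, h4⟩ := mem_ncFinset.1 hπ
      obtain ⟨B, ⟨hB, haB⟩, -⟩ := h2 a (Finset.mem_insert_self _ _)
      obtain ⟨k, hka, rfl⟩ : ∃ k, k ≠ a ∧ B = {a, k} := by
        obtain ⟨x, y, hxy, rfl⟩ := Finset.card_eq_two.1 (h1 B hB).2
        rcases Finset.mem_insert.1 haB with rfl | h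
        · exact ⟨y, hxy.symm, rfl⟩
        · rw [Finset.mem_singleton] at h
          subst h
          exact ⟨x, hxy, Finset.pair_comm _ _⟩
      have hk := (h1 _ hB).1 (by simp : k ∈ ({a, k} : Finset ℕ))
      exact ⟨k, ⟨(Finset.mem_insert.1 hk).resolve_left hka,
        h4 _ hB k (by simp) a (by simp) hka⟩, hπ, hB⟩
    · rintro ⟨k, -, hπ, -⟩
      exact hπ
  rw [hU, Finset.card_biUnion]
  · refine Finset.sum_congr rfl fun k hk => ?_
    rw [Finset.mem_filter] at hk
    exact card_filter_pair_mem ha hk.1 hk.2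
  · intro k hk l hl hkl
    refine Finset.disjoint_left.2 fun π hπ hπ' => ?_
    rw [Finset.mem_filter] at hπ hπ'
    rw [Finset.mem_coe, Finset.mem_filter] at hk hl
    have := ((mem_ncFinset.1 hπ.1).2.1 a (Finset.mem_insert_self _ _)).unique
      ⟨hπ.2, by simp⟩ ⟨hπ'.2, by simp⟩
    have hk' : k ∈ ({a, l} : Finset ℕ) := this ▸ (by simp)
    have := ha k hk.1
    simp only [Finset.mem_insert, Finset.mem_singleton] at hk'
    omega

theorem phi_nil : phi [] = 1 := by
  rw [phi_eq_card_ncFinset [] 0 (fun _ => false) (fun i => i.elim0), Finset.card_eq_one]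
  refine ⟨∅, ?_⟩
  ext π
  rw [mem_ncFinset, Finset.mem_singleton]
  constructor
  · rintro ⟨h1, -⟩
    refine Finset.eq_empty_of_forall_notMem fun B hB => ?_
    obtain ⟨h2, h3⟩ := h1 B hB
    have : B = ∅ := by simpa using h2
    simp [this] at h3
  · rintro rfl
    simp [ncSet]

/-- Recursion on the partner of the first letter. -/
theorem phi_cons (b : Bool) (u : List Bool) :
    phi (b :: u) = ∑ i ∈ Finset.range u.length,
      if u[i]? = some (!b) then phi (u.take i) * phi (u.drop (i + 1)) else 0 := by
  let c : ℕ → Bool := fun i => (b :: u).getD i false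
  have hc : ∀ i, c (i + 1) = u.getD i false := fun i => by simp [c]
  rw [phi_eq_card_ncFinset (b :: u) 0 c (fun i => by
    simp only [c, zero_add, List.getD_eq_getElem _ _ i.2, List.get_eq_getElem])]
  have hs : Finset.Ico 0 (0 + (b :: u).length) = insert 0 (Finset.Ico 1 (1 + u.length)) := by
    ext x; simp; omega
  rw [hs, card_ncFinset_insert (by simp; omega), Finset.sum_filter, Finset.sum_Ico_eq_sum_range,
    Nat.add_sub_cancel_left]
  refine Finset.sum_congr rfl fun i hi => ?_
  rw [Finset.mem_range] at hi
  have e1 : c (1 + i) ≠ c 0 ↔ u[i]? = some (!b) := by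
    rw [add_comm, hc, List.getD_eq_getElem?_getD, List.getElem?_eq_getElem hi]
    simp [c]
    cases u[i] <;> cases b <;> simp
  rw [if_congr e1 rfl rfl]
  split_ifs
  · rw [phi_eq_card_ncFinset (u.take i) 1 c, phi_eq_card_ncFinset (u.drop (i + 1)) (i + 2) c]
    · congr 3
      · ext x; simp; omega
      · ext x; simp; omega
    · intro j
      have hj : (j : ℕ) < u.length - (i + 1) := List.length_drop ▸ j.2
      rw [show i + 2 + (j : ℕ) = (i + 1 + j) + 1 by omega, hc, List.getD_eq_getElem _ _ (by omega)]
      simp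
    · intro j
      have hj : (j : ℕ) < min i u.length := List.length_take ▸ j.2
      rw [add_comm, hc, List.getD_eq_getElem _ _ (by omega)]
      simp
  · rfl

/-- Cyclic rotation by one letter. -/
theorem phi_rotate_one (b : Bool) (u : List Bool) : phi (b :: u) = phi (u ++ [b]) := by
  let c : ℕ → Bool := fun i => (b :: u).getD i false
  have hL : (u ++ [b]).length = u.length + 1 := by simp
  let f : Fin (u ++ [b]).length ↪ ℕ := ⟨fun i => if (i : ℕ) = u.length then 0 else i + 1, by
    intro i j hij
    ext
    simp only at hij
    split_ifs at hij <;> omega⟩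
  have hf : ∀ i, f i = if (i : ℕ) = u.length then 0 else (i : ℕ) + 1 := fun _ => rfl
  have hlt : ∀ i : Fin (u ++ [b]).length, (i : ℕ) < u.length + 1 := fun i => hL ▸ i.2
  have hfi : ∀ i : Fin (u ++ [b]).length,
      ((i : ℕ) = u.length ∧ f i = 0) ∨ ((i : ℕ) < u.length ∧ f i = i + 1) := by
    intro i
    have := hlt i
    rw [hf]
    split_ifs <;> omega
  rw [phi_eq_card_ncFinset (b :: u) 0 c (fun i => by
    simp only [c, zero_add, List.getD_eq_getElem _ _ i.2, List.get_eq_getElem]),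
    phi_eq_card_ncFinset_of_embedding (u ++ [b]) _ c f]
  · intro x
    rw [Finset.mem_Ico, List.length_cons]
    constructor
    · rintro ⟨-, h⟩
      rcases Nat.eq_zero_or_pos x with rfl | hx
      · exact ⟨⟨u.length, by simp⟩, by simp [hf]⟩
      · refine ⟨⟨x - 1, by omega⟩, ?_⟩
        rw [hf, if_neg (by simp only; omega)]
        simp only
        omega
    · rintro ⟨i, rfl⟩
      have := hfi i
      omega
  · intro i
    rcases hfi i with ⟨h1, h2⟩ | ⟨h1, h2⟩
    · simp [h1, h2, c]
    · simp [h2, c, h1, List.getElem_append_left]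
  · intro i₁ j₁ i₂ j₂ h1 h2 h3
    have := hfi i₁
    have := hfi j₁
    have := hfi i₂
    have := hfi j₂
    simp only [Fin.lt_def]
    omega
  · intro i₁ j₁ i₂ j₂ h1 h2 h3
    have := hfi i₁
    have := hfi j₁
    have := hfi i₂
    have := hfi j₂
    simp only [Fin.lt_def] at h1 h2 h3
    omega

theorem phi_append_comm (u v : List Bool) : phi (u ++ v) = phi (v ++ u) := by
  induction u generalizing v with
  | nil => simp
  | cons b u ih =>
    rw [List.cons_append, phi_rotate_one, List.append_assoc, ih, List.append_assoc,
      List.singleton_append]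

theorem phi_eq_zero_of_count_ne (w : List Bool) (h : w.count true ≠ w.count false) :
    phi w = 0 := by
  induction hn : w.length using Nat.strong_induction_on generalizing w with
  | _ N ih =>
    cases w with
    | nil => simp at h
    | cons b u =>
      rw [phi_cons]
      refine Finset.sum_eq_zero fun i hi => ?_
      rw [Finset.mem_range] at hi
      rw [List.length_cons] at hn
      split_ifs with hb
      · rw [List.getElem?_eq_getElem hi, Option.some_inj] at hb
        have hu : u = u.take i ++ (!b) :: u.drop (i + 1) := by
          rw [← hb, ← List.drop_eq_getElem_cons hi, List.take_append_drop]
        by_cases h1 : (u.take i).count true = (u.take i).count false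
        · have h2 : (u.drop (i + 1)).count true ≠ (u.drop (i + 1)).count false := by
            intro h2
            apply h
            rw [hu]
            cases b <;> simp [h1, h2] <;> omega
          rw [ih _ (by rw [List.length_drop]; omega) _ h2 rfl, mul_zero]
        · rw [ih _ (by rw [List.length_take]; omega) _ h1 rfl, zero_mul]
      · rfl

/-- The sum of `phi (x ++ v) * phi w` over all factorizations `v ++ false :: w` of the second
argument. -/
noncomputable def splitSum : List Bool → List Bool → ℕ
  | _, [] => 0
  | x, true :: u => splitSum (x ++ [true]) u
  | x, false :: u => phi x * phi u + splitSum (x ++ [false]) u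

theorem splitSum_eq_sum (x u : List Bool) :
    splitSum x u = ∑ i ∈ Finset.range u.length,
      if u[i]? = some false then phi (x ++ u.take i) * phi (u.drop (i + 1)) else 0 := by
  induction u generalizing x with
  | nil => simp [splitSum]
  | cons b u ih =>
    rw [List.length_cons, Finset.sum_range_succ']
    cases b <;> simp [splitSum, ih, add_comm (phi x * phi u)]

theorem phi_true_cons (u : List Bool) : phi (true :: u) = splitSum [] u := by
  rw [phi_cons, splitSum_eq_sum]
  simp

theorem splitSum_replicate_true (x : List Bool) (m : ℕ) (z : List Bool) :
    splitSum x (List.replicate m true ++ z) = splitSum (x ++ List.replicate m true) z := by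
  induction m generalizing x with
  | zero => simp
  | succ m ih => simp [List.replicate_succ, splitSum, ih]

theorem splitSum_replicate_false (x : List Bool) (k : ℕ) (z : List Bool)
    (h : ∀ j < k, x.count true ≠ x.count false + j) :
    splitSum x (List.replicate k false ++ z) = splitSum (x ++ List.replicate k false) z := by
  induction k generalizing x with
  | zero => simp
  | succ k ih =>
    rw [List.replicate_succ, List.cons_append, splitSum,
      phi_eq_zero_of_count_ne x (h 0 (Nat.succ_pos k)), zero_mul, zero_add, ih]
    · simp
    · intro j hj
      have := h (j + 1) (by omega)
      simp
      omega

theorem symWord_nil : symWord [] = [] := rfl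

theorem symWord_cons (m : ℕ) (t : List ℕ) :
    symWord (m :: t) = List.replicate m true ++ (List.replicate m false ++ symWord t) := by
  simp [symWord]

theorem symWord_append (s t : List ℕ) : symWord (s ++ t) = symWord s ++ symWord t := by
  simp [symWord]

theorem count_symWord (t : List ℕ) : (symWord t).count true = (symWord t).count false := by
  induction t with
  | nil => rfl
  | cons m t ih => simp [symWord_cons, List.count_replicate, ih]

theorem phiStar_nil : phiStar [] = 1 := phi_nil

theorem phiStar_zero_cons (t : List ℕ) : phiStar (0 :: t) = phiStar t := by
  simp [phiStar, symWord_cons]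

theorem splitSum_symWord (a : ℕ) (s t : List ℕ) (ht : ∀ m ∈ t, a + 1 ≤ m) :
    splitSum (List.replicate (a + 1) false ++ symWord s) (symWord t ++ List.replicate a true) =
      ∑ p ∈ Finset.range t.length, phiStar (s ++ t.take (p + 1)) * phiStar (a :: t.drop (p + 1)) := by
  induction t generalizing s with
  | nil =>
    have := splitSum_replicate_true (List.replicate (a + 1) false ++ symWord s) a []
    rw [List.append_nil] at this
    simp [symWord_nil, this, splitSum]
  | cons m t ih =>
    obtain ⟨d, rfl⟩ : ∃ d, m = d + (a + 1) := ⟨m - (a + 1), by have := ht m (by simp); omega⟩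
    have hs := count_symWord s
    have e : symWord ((d + (a + 1)) :: t) ++ List.replicate a true =
        List.replicate (d + (a + 1)) true ++ (List.replicate d false ++
          (false :: (List.replicate a false ++ (symWord t ++ List.replicate a true)))) := by
      rw [symWord_cons, List.replicate_add d (a + 1) false, List.replicate_succ]
      simp
    have e1 : phi (List.replicate (a + 1) false ++ symWord s ++ List.replicate (d + (a + 1)) true ++
        List.replicate d false) = phiStar (s ++ [d + (a + 1)]) := by
      rw [phiStar, symWord_append, symWord_cons, symWord_nil, List.append_nil, List.append_assoc,
        List.append_assoc, phi_append_comm, List.replicate_add d (a + 1) false]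
      simp only [List.append_assoc]
    have e2 : phi (List.replicate a false ++ (symWord t ++ List.replicate a true)) =
        phiStar (a :: t) := by
      rw [phiStar, symWord_cons, ← List.append_assoc, phi_append_comm]
    have e3 : List.replicate (a + 1) false ++ symWord s ++ List.replicate (d + (a + 1)) true ++
        List.replicate d false ++ [false] ++ List.replicate a false =
        List.replicate (a + 1) false ++ symWord (s ++ [d + (a + 1)]) := by
      rw [symWord_append, symWord_cons, symWord_nil, List.append_nil,
        List.replicate_add d (a + 1) false, List.replicate_succ (n := a) (a := false)]
      simp only [List.append_assoc, List.singleton_append]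
    rw [e, splitSum_replicate_true, splitSum_replicate_false, splitSum, e1, e2,
      splitSum_replicate_false, e3, ih _ (fun m hm => ht m (List.mem_cons_of_mem _ hm)),
      List.length_cons, Finset.sum_range_succ']
    · simp [add_comm (phiStar (s ++ [d + (a + 1)]) * phiStar (a :: t))]
    · intro j hj
      simp [List.count_replicate, hs]
      omega
    · intro j hj
      simp [List.count_replicate, hs]
      omega

/-- The recursion on the first argument of `phiStar`, when it is minimal. -/
theorem phiStar_succ_cons (a : ℕ) (t : List ℕ) (ht : ∀ m ∈ t, a + 1 ≤ m) :
    phiStar ((a + 1) :: t) =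
      ∑ p ∈ Finset.range (t.length + 1), phiStar (t.take p) * phiStar (a :: t.drop p) := by
  have e : phiStar ((a + 1) :: t) =
      phi (true :: (List.replicate (a + 1) false ++ (symWord t ++ List.replicate a true))) := by
    rw [phiStar, symWord_cons, List.replicate_succ' (n := a), List.append_assoc, phi_append_comm]
    simp only [List.append_assoc, List.nil_append, List.cons_append]
  have e2 : phi (List.replicate a false ++ (symWord t ++ List.replicate a true)) =
      phiStar (a :: t) := by
    rw [phiStar, symWord_cons, ← List.append_assoc, phi_append_comm]
  have e3 := splitSum_symWord a [] t ht
  rw [symWord_nil, List.append_nil] at e3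
  rw [e, phi_true_cons, List.replicate_succ, List.cons_append, splitSum, e2,
    splitSum_replicate_false, List.nil_append, List.singleton_append, ← List.replicate_succ, e3,
    Finset.sum_range_succ', phi_nil]
  · simp [phiStar_nil, add_comm]
  · intro j hj
    simp
    omega

theorem phiStar_singleton (a : ℕ) : phiStar [a] = 1 := by
  induction a with
  | zero => rw [phiStar_zero_cons, phiStar_nil]
  | succ a ih => rw [phiStar_succ_cons a [] (by simp)]; simp [phiStar_nil, ih]

theorem phiStarCuts_singleton (t : List ℕ) (r i : ℕ) :
    phiStarCuts t r [i] = phiStar ((t.drop (i - 1)).take (r - i)) := by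
  simp [phiStarCuts]

theorem phiStarCuts_cons_cons (t : List ℕ) (r i k : ℕ) (L : List ℕ) :
    phiStarCuts t r (i :: k :: L) =
      phiStar ((t.drop (i - 1)).take (k - i)) * phiStarCuts t r (k :: L) := by
  simp [phiStarCuts]

/-- The sum over the cut-sets with first cut `i` and the other cuts in `[k, r)`, weighted by their
number. -/
noncomputable def cutSum (t : List ℕ) (r : ℕ) (c : ℕ → ℕ) (i k : ℕ) : ℕ :=
  ∑ S ∈ (Finset.Ico k r).powerset, c S.card * phiStarCuts t r ((insert i S).sort (· ≤ ·))

theorem sort_insert_of_lt {i : ℕ} {S : Finset ℕ} (h : ∀ x ∈ S, i < x) :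
    (insert i S).sort (· ≤ ·) = i :: S.sort (· ≤ ·) :=
  Finset.sort_insert (· ≤ ·) (fun x hx => (h x hx).le) fun hi => lt_irrefl i (h i hi)

theorem cutSum_of_le {t : List ℕ} {r : ℕ} (c : ℕ → ℕ) {i k : ℕ} (h : r ≤ k) :
    cutSum t r c i k = c 0 * phiStar ((t.drop (i - 1)).take (r - i)) := by
  simp [cutSum, Finset.Ico_eq_empty_of_le h, phiStarCuts_singleton]

theorem cutSum_step {t : List ℕ} {r : ℕ} (c : ℕ → ℕ) {i k : ℕ} (hik : i < k) (hkr : k < r) :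
    cutSum t r c i k = cutSum t r c i (k + 1) +
      phiStar ((t.drop (i - 1)).take (k - i)) * cutSum t r (fun s => c (s + 1)) k (k + 1) := by
  have hI : Finset.Ico k r = insert k (Finset.Ico (k + 1) r) := by
    ext x; simp; omega
  have hk : k ∉ Finset.Ico (k + 1) r := by simp
  rw [cutSum, hI, Finset.sum_powerset_insert hk, cutSum, cutSum, Finset.mul_sum]
  congr 1
  refine Finset.sum_congr rfl fun S hS => ?_
  have hS' : ∀ x ∈ S, k < x := fun x hx => by
    have := Finset.mem_Ico.1 (Finset.mem_powerset.1 hS hx)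
    omega
  have hi : ∀ x ∈ insert k S, i < x := by
    intro x hx
    rcases Finset.mem_insert.1 hx with rfl | hx
    · exact hik
    · exact hik.trans (hS' x hx)
  rw [sort_insert_of_lt hi, sort_insert_of_lt hS', phiStarCuts_cons_cons,
    Finset.card_insert_of_notMem fun h => lt_irrefl k (hS' k h)]
  ring

theorem cutSum_eq {t : List ℕ} {r : ℕ} (c : ℕ → ℕ) {i k : ℕ} (hik : i < k) :
    cutSum t r c i k = c 0 * phiStar ((t.drop (i - 1)).take (r - i)) +
      ∑ j ∈ Finset.Ico k r, phiStar ((t.drop (i - 1)).take (j - i)) *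
        cutSum t r (fun s => c (s + 1)) j (j + 1) := by
  induction hd : r - k generalizing k with
  | zero =>
    have hrk : r ≤ k := by omega
    simp [cutSum_of_le c hrk, Finset.Ico_eq_empty_of_le hrk]
  | succ d ih =>
    have hkr : k < r := by omega
    rw [cutSum_step c hik hkr, ih (by omega) (by omega), Finset.sum_eq_sum_Ico_succ_bot hkr]
    ring

theorem phiStar_cons_drop_eq_cutSum {t : List ℕ} {r : ℕ} (hlen : t.length = r - 1) (a : ℕ)
    (ht : ∀ m ∈ t, a ≤ m) {i : ℕ} (h1 : 1 ≤ i) (hir : i < r) :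
    phiStar (a :: t.drop (i - 1)) =
      cutSum t r (fun s => (a + 1).choose (s + 1)) i (i + 1) := by
  have hfull : ∀ i, 1 ≤ i → (t.drop (i - 1)).take (r - i) = t.drop (i - 1) := fun i hi =>
    List.take_of_length_le (by rw [List.length_drop]; omega)
  induction a generalizing i with
  | zero =>
    rw [cutSum_eq _ (Nat.lt_succ_self i), hfull i h1, phiStar_zero_cons, Finset.sum_eq_zero]
    · simp
    · intro j _
      simp [cutSum, Nat.choose_eq_zero_of_lt]
  | succ a ih =>
    have ht' : ∀ m ∈ t, a ≤ m := fun m hm => (Nat.le_succ a).trans (ht m hm)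
    have hsplit : cutSum t r (fun s => (a + 1 + 1).choose (s + 1)) i (i + 1) =
        cutSum t r (fun s => (a + 1).choose s) i (i + 1) +
          cutSum t r (fun s => (a + 1).choose (s + 1)) i (i + 1) := by
      simp only [cutSum, ← Finset.sum_add_distrib, ← add_mul, ← Nat.choose_succ_succ']
    have hdl : (t.drop (i - 1)).length = (r - (i + 1)) + 1 := by
      rw [List.length_drop]
      omega
    rw [hsplit, ← ih ht' h1 hir, cutSum_eq _ (Nat.lt_succ_self i), hfull i h1,
      phiStar_succ_cons a _ (fun m hm => ht m (List.mem_of_mem_drop hm)), Finset.sum_range_succ',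
      hdl, Finset.sum_range_succ, ← hdl, List.take_length, List.drop_length, phiStar_singleton,
      Finset.sum_Ico_eq_sum_range]
    simp only [List.take_zero, List.drop_zero, phiStar_nil, one_mul, mul_one, Nat.choose_zero_right]
    rw [add_comm (Finset.sum _ _) (phiStar (List.drop (i - 1) t))]
    congr 2
    refine Finset.sum_congr rfl fun p hp => ?_
    rw [Finset.mem_range] at hp
    rw [← ih ht' (by omega) (by omega), List.drop_drop]
    congr 3
    · omega
    · congr 1
      omega

/-- If `r ≥ 3` and `n 1` is minimal, then
`φ*(n₁,…,n_r) = Σ_{S ⊆ {2,…,r-1}} C(n₁+1, |S|+1) · φ*_{S∪{1}}(n₂,…,n_r)`. -/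
theorem stmt13 (r : ℕ) (hr : 3 ≤ r) (n : ℕ → ℕ)
    (hpos : ∀ i, 1 ≤ i → i ≤ r → 1 ≤ n i)
    (hmin : ∀ i, 1 ≤ i → i ≤ r → n 1 ≤ n i) :
    phiStar ((List.range r).map fun k => n (k + 1)) =
      ∑ S ∈ (Finset.Icc 2 (r - 1)).powerset,
        Nat.choose (n 1 + 1) (S.card + 1) *
          phiStarCuts ((List.range (r - 1)).map fun k => n (k + 2)) r
            ((insert 1 S).sort (· ≤ ·)) := by
  have e : (List.range r).map (fun k => n (k + 1)) =
      n 1 :: (List.range (r - 1)).map fun k => n (k + 2) := by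
    obtain ⟨q, rfl⟩ : ∃ q, r = q + 1 := ⟨r - 1, by omega⟩
    simp [List.range_succ_eq_map, Function.comp_def]
  have hlen : ((List.range (r - 1)).map fun k => n (k + 2)).length = r - 1 := by simp
  have ht : ∀ m ∈ (List.range (r - 1)).map fun k => n (k + 2), n 1 ≤ m := by
    intro m hm
    obtain ⟨k, hk, rfl⟩ := List.mem_map.1 hm
    rw [List.mem_range] at hk
    exact hmin (k + 2) (by omega) (by omega)
  have hI : Finset.Icc 2 (r - 1) = Finset.Ico 2 r := by
    ext x
    simp only [Finset.mem_Icc, Finset.mem_Ico]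
    omega
  rw [e, hI]
  exact phiStar_cons_drop_eq_cutSum hlen (n 1) ht le_rfl (by omega)
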